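/- Assume that for every μ ∈ ℝⁿ with μ ≠ 0, the solution x_μ := Σ_{j=1}^{n} μ_j x_{−,j} does not tend to 0 as t → −∞ (transversality of the stable and unstable subspaces). Then there exists C > 0 such that for all μ ∈ ℝⁿ and all s, t ∈ ℝ, one has |x_μ(t + s)| ≤ C·e^{−t}·|x_μ(s)|. This is the uniform exponential contraction on the stable subspace of the linearized geodesic flow. -/

import Mathlib

open Real Filter Topology

noncomputable section

/-- The phase space `ℝ^{2n} = ℝⁿ × ℝⁿ` with the Euclidean norm. -/
abbrev EucV (n : ℕ) := EuclideanSpace ℝ (Fin n ⊕ Fin n)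

/-- The block matrix `A = [[0, I],[I, 0]]`, i.e. `A (y, z) = (z, y)`. -/
def Amap (n : ℕ) : EucV n →L[ℝ] EucV n :=
  LinearMap.toContinuousLinearMap
    { toFun := fun x => (WithLp.equiv 2 _).symm fun i => x i.swap
      map_add' := fun _ _ => rfl
      map_smul' := fun _ _ => rfl }

/-- `x` is a solution of `x′(t) = (A + E(t))·x(t)`. -/
def IsSol (n : ℕ) (E : ℝ → (EucV n →L[ℝ] EucV n)) (x : ℝ → EucV n) : Prop :=
  ∀ t : ℝ, HasDerivAt x (Amap n (x t) + E t (x t)) t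

/-- The eigenvector `e_j^σ = (e_j, σ e_j)` of `A`, for `σ = ±1`. -/
def eVec (n : ℕ) (σ : ℝ) (j : Fin n) : EucV n :=
  EuclideanSpace.single (Sum.inl j) (1 : ℝ) + EuclideanSpace.single (Sum.inr j) σ

section Perturbation

theorem exp_neg_abs_le_two_div (t : ℝ) : Real.exp (-|t|) ≤ 2 * (1 / (1 + t ^ 2)) := by
  have h := Real.quadratic_le_exp_of_nonneg (abs_nonneg t)
  have h0 := abs_nonneg t
  rw [sq_abs] at h
  rw [Real.exp_neg, mul_one_div, inv_eq_one_div, div_le_div_iff₀ (Real.exp_pos _) (by positivity)]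
  linarith

/-- Grönwall in monotone form: if `f' + h' f ≥ 0` then `f * exp h` is monotone. -/
theorem monotoneOn_mul_exp {f f' h h' : ℝ → ℝ} {s : Set ℝ} (hs : Convex ℝ s)
    (hf : ∀ t, HasDerivAt f (f' t) t) (hh : ∀ t, HasDerivAt h (h' t) t)
    (hnn : ∀ t ∈ s, 0 ≤ f' t + h' t * f t) :
    MonotoneOn (fun t => f t * Real.exp (h t)) s := by
  have hd : ∀ t, HasDerivAt (fun t => f t * Real.exp (h t))
      ((f' t + h' t * f t) * Real.exp (h t)) t := fun t => by
    refine ((hf t).mul (hh t).exp).congr_deriv ?_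
    ring
  refine monotoneOn_of_deriv_nonneg hs (fun t _ => (hd t).continuousAt.continuousWithinAt)
    (fun t _ => (hd t).differentiableAt.differentiableWithinAt) fun t ht => ?_
  rw [(hd t).deriv]
  exact mul_nonneg (hnn t (interior_subset ht)) (Real.exp_pos _).le

variable {H : Type*} [NormedAddCommGroup H] [InnerProductSpace ℝ H]

theorem abs_inner_apply_le {L : H →L[ℝ] H} {c : ℝ} (hL : ‖L‖ ≤ c) {u v : H} (huv : ‖u‖ = ‖v‖) :
    |inner ℝ u (L v)| ≤ c * ‖v‖ ^ 2 := by
  refine (abs_real_inner_le_norm _ _).trans ?_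
  have h : ‖L v‖ ≤ c * ‖v‖ := L.le_of_opNorm_le hL v
  rw [huv]
  nlinarith [norm_nonneg v]

theorem abs_inner_le_sq {u v : H} (huv : ‖u‖ = ‖v‖) : |inner ℝ u v| ≤ ‖v‖ ^ 2 := by
  refine (abs_real_inner_le_norm _ _).trans ?_
  rw [huv, sq]

theorem hasDerivAt_mul_arctan (a b : ℝ) (c : ℝ) (t : ℝ) :
    HasDerivAt (fun t => a * t + b * (c * Real.arctan t)) (a + b * (c * (1 / (1 + t ^ 2)))) t := by
  refine (((hasDerivAt_id t).const_mul a).add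
    (((Real.hasDerivAt_arctan t).const_mul c).const_mul b)).congr_deriv ?_
  rw [mul_one]

theorem abs_mul_arctan_le {c : ℝ} (hc : 0 ≤ c) (t : ℝ) :
    |c * Real.arctan t| ≤ c * (π / 2) := by
  rw [abs_mul, abs_of_nonneg hc]
  exact mul_le_mul_of_nonneg_left
    (abs_le.2 ⟨(Real.neg_pi_div_two_lt_arctan t).le, (Real.arctan_lt_pi_div_two t).le⟩) hc

variable {A : H →L[ℝ] H} {E : ℝ → (H →L[ℝ] H)} {x : ℝ → H} {c : ℝ}

/-- Along solutions of `x' = (A + E) x`, with `A` isometric, `exp t * ‖x t‖` is monotone up to a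
multiplicative constant. -/
theorem exp_smul_norm_le_of_le (hAn : ∀ v, ‖A v‖ = ‖v‖) (hc : 0 ≤ c)
    (hE : ∀ t, ‖E t‖ ≤ c * (1 / (1 + t ^ 2)))
    (hx : ∀ t, HasDerivAt x (A (x t) + E t (x t)) t) {s t : ℝ} (hst : s ≤ t) :
    ‖Real.exp s • x s‖ ≤ Real.exp (c * π) * ‖Real.exp t • x t‖ := by
  have hmono := monotoneOn_mul_exp (s := Set.univ) convex_univ (fun t => (hx t).norm_sq)
    (hasDerivAt_mul_arctan 2 2 c) (fun t _ => by
      have h1 := abs_le.1 (abs_inner_le_sq (hAn (x t)))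
      have h2 := abs_le.1 (abs_inner_apply_le (hE t) (rfl : ‖x t‖ = ‖x t‖))
      rw [real_inner_comm] at h1
      rw [inner_add_right]
      nlinarith) (Set.mem_univ s) (Set.mem_univ t) hst
  have hs := (abs_le.1 (abs_mul_arctan_le hc s)).1
  have ht := (abs_le.1 (abs_mul_arctan_le hc t)).2
  rw [norm_smul, norm_smul, Real.norm_of_nonneg (Real.exp_pos _).le,
    Real.norm_of_nonneg (Real.exp_pos _).le]
  refine le_of_sq_le_sq ?_ (by positivity)
  have h1 : Real.exp s ^ 2 * Real.exp (-(c * π)) ≤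
      Real.exp (2 * s + 2 * (c * Real.arctan s)) := by
    rw [← Real.exp_nat_mul, ← Real.exp_add]
    exact Real.exp_le_exp.2 (by push_cast; linarith)
  have h2 : Real.exp (2 * t + 2 * (c * Real.arctan t)) ≤ Real.exp t ^ 2 * Real.exp (c * π) := by
    rw [← Real.exp_nat_mul, ← Real.exp_add]
    exact Real.exp_le_exp.2 (by push_cast; linarith)
  have h3 : ‖x s‖ ^ 2 * (Real.exp s ^ 2 * Real.exp (-(c * π))) ≤
      ‖x t‖ ^ 2 * (Real.exp t ^ 2 * Real.exp (c * π)) :=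
    (mul_le_mul_of_nonneg_left h1 (sq_nonneg _)).trans
      (hmono.trans (mul_le_mul_of_nonneg_left h2 (sq_nonneg _)))
  have h4 : Real.exp (-(c * π)) * Real.exp (c * π) = 1 := by
    rw [← Real.exp_add, neg_add_cancel, Real.exp_zero]
  calc (Real.exp s * ‖x s‖) ^ 2
      = ‖x s‖ ^ 2 * (Real.exp s ^ 2 * Real.exp (-(c * π))) * Real.exp (c * π) := by
        linear_combination (-(Real.exp s * ‖x s‖) ^ 2) * h4
    _ ≤ ‖x t‖ ^ 2 * (Real.exp t ^ 2 * Real.exp (c * π)) * Real.exp (c * π) := by gcongr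
    _ = (Real.exp (c * π) * (Real.exp t * ‖x t‖)) ^ 2 := by ring

/-- A solution of `x' = (A + E) x` which is `o(exp (-t))` at `-∞` tends to zero there. -/
theorem tendsto_zero_of_exp_smul_tendsto_zero (hAn : ∀ v, ‖A v‖ = ‖v‖)
    (hAs : ∀ u v, inner ℝ (A u) v = inner ℝ u (A v)) (hc : 0 ≤ c)
    (hE : ∀ t, ‖E t‖ ≤ c * (1 / (1 + t ^ 2)))
    (hx : ∀ t, HasDerivAt x (A (x t) + E t (x t)) t)
    (hlim : Tendsto (fun t => Real.exp t • x t) atBot (𝓝 0)) :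
    Tendsto x atBot (𝓝 0) := by
  have hB : ∀ t, HasDerivAt (fun t => inner ℝ (A (x t)) (x t))
      (2 * (‖x t‖ ^ 2 + inner ℝ (A (x t)) (E t (x t)))) t := fun t => by
    have hAx : HasDerivAt (fun t => A (x t)) (A (A (x t) + E t (x t))) t :=
      A.hasFDerivAt.comp_hasDerivAt t (hx t)
    refine (hAx.inner ℝ (hx t)).congr_deriv ?_
    rw [hAs (A (x t) + E t (x t)) (x t), inner_add_left, inner_add_right,
      real_inner_self_eq_norm_sq, hAn, real_inner_comm (A (x t)) (E t (x t))]
    ring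
  have habs : ∀ t, |inner ℝ (A (x t)) (x t)| ≤ ‖x t‖ ^ 2 := fun t => abs_inner_le_sq (hAn (x t))
  have hmono := monotoneOn_mul_exp (convex_Iic (-(c + 1))) hB
    (hasDerivAt_mul_arctan 2 (-2) c) (fun t ht => by
      have h1 := abs_le.1 (habs t)
      have h2 := abs_le.1 (abs_inner_apply_le (hE t) (hAn (x t)))
      have h3 : c * (1 / (1 + t ^ 2)) ≤ 1 := by
        rw [mul_one_div, div_le_one (by positivity)]
        have ht' : t ≤ -(c + 1) := ht
        nlinarith
      nlinarith)
  have hBnn : ∀ t ≤ -(c + 1), 0 ≤ inner ℝ (A (x t)) (x t) := fun t ht => by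
    have hz : Tendsto (fun t => inner ℝ (A (x t)) (x t) *
        Real.exp (2 * t + -2 * (c * Real.arctan t))) atBot (𝓝 0) := by
      have hsq : Tendsto (fun t => Real.exp (c * π) * ‖Real.exp t • x t‖ ^ 2) atBot (𝓝 0) := by
        simpa using (hlim.norm.pow 2).const_mul (Real.exp (c * π))
      refine squeeze_zero_norm (fun t => ?_) hsq
      have ha := (abs_le.1 (abs_mul_arctan_le hc t)).1
      rw [norm_mul, Real.norm_of_nonneg (Real.exp_pos _).le, norm_smul,
        Real.norm_of_nonneg (Real.exp_pos _).le, Real.norm_eq_abs, mul_pow, ← Real.exp_nat_mul,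
        ← mul_assoc (Real.exp (c * π)), ← Real.exp_add, mul_comm]
      refine mul_le_mul (Real.exp_le_exp.2 ?_) (habs t) (abs_nonneg _) (Real.exp_pos _).le
      push_cast
      linarith
    have h0 := le_of_tendsto hz ((eventually_le_atBot t).mono fun r hr =>
      hmono (hr.trans ht : r ≤ -(c + 1)) (ht : t ≤ -(c + 1)) hr)
    exact nonneg_of_mul_nonneg_left h0 (Real.exp_pos _)
  have hmono' := monotoneOn_mul_exp (convex_Iic (-(c + 1)))
    (fun t => (hx t).norm_sq.add (hB t)) (hasDerivAt_mul_arctan (-2) 4 c) (fun t ht => by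
      have h0 := hBnn t ht
      have h1 := abs_le.1 (abs_inner_apply_le (hE t) (hAn (x t)))
      have h2 := abs_le.1 (abs_inner_apply_le (hE t) (rfl : ‖x t‖ = ‖x t‖))
      have h3 : 0 ≤ c * (1 / (1 + t ^ 2)) := by positivity
      simp only [Pi.add_apply]
      rw [inner_add_right, real_inner_comm (A (x t)) (x t)]
      nlinarith [mul_nonneg h3 h0])
  set K := (‖x (-(c + 1))‖ ^ 2 + inner ℝ (A (x (-(c + 1)))) (x (-(c + 1)))) *
    Real.exp (-2 * (-(c + 1)) + 4 * (c * Real.arctan (-(c + 1)))) with hK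
  have hbound : ∀ t ≤ -(c + 1), ‖x t‖ ^ 2 ≤ K * Real.exp (2 * (c * π)) * Real.exp t ^ 2 := by
    intro t ht
    have h := hmono' (ht : t ≤ -(c + 1)) (le_refl (-(c + 1)) : _) ht
    simp only [Pi.add_apply] at h
    rw [← hK] at h
    have ha := (abs_le.1 (abs_mul_arctan_le hc t)).1
    have h0 := hBnn t ht
    have h4 : Real.exp (-2 * t - 2 * (c * π)) ≤ Real.exp (-2 * t + 4 * (c * Real.arctan t)) :=
      Real.exp_le_exp.2 (by linarith)
    have h5 : ‖x t‖ ^ 2 * Real.exp (-2 * t - 2 * (c * π)) ≤ K :=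
      (mul_le_mul (by linarith) h4 (Real.exp_pos _).le (by positivity)).trans h
    have h6 : Real.exp (-2 * t - 2 * (c * π)) * (Real.exp (2 * (c * π)) * Real.exp t ^ 2) = 1 := by
      rw [← Real.exp_nat_mul, ← Real.exp_add, ← Real.exp_add, Real.exp_eq_one_iff]
      push_cast
      ring
    calc ‖x t‖ ^ 2 = ‖x t‖ ^ 2 * Real.exp (-2 * t - 2 * (c * π)) *
          (Real.exp (2 * (c * π)) * Real.exp t ^ 2) := by rw [mul_assoc, h6, mul_one]
      _ ≤ K * (Real.exp (2 * (c * π)) * Real.exp t ^ 2) := by gcongr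
      _ = _ := by ring
  have hsq : Tendsto (fun t => ‖x t‖ ^ 2) atBot (𝓝 0) := by
    refine squeeze_zero' (Eventually.of_forall fun t => by positivity)
      ((eventually_le_atBot (-(c + 1))).mono hbound) ?_
    simpa using (Real.tendsto_exp_atBot.pow 2).const_mul (K * Real.exp (2 * (c * π)))
  rw [tendsto_zero_iff_norm_tendsto_zero]
  simpa [Real.sqrt_sq] using hsq.sqrt

/-- A nontrivial lower bound for `exp t * ‖x t‖` along solutions not tending to zero at `-∞`. -/
theorem exists_pos_le_exp_smul_norm (hAn : ∀ v, ‖A v‖ = ‖v‖)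
    (hAs : ∀ u v, inner ℝ (A u) v = inner ℝ u (A v)) (hc : 0 ≤ c)
    (hE : ∀ t, ‖E t‖ ≤ c * (1 / (1 + t ^ 2)))
    (hx : ∀ t, HasDerivAt x (A (x t) + E t (x t)) t) (hlim : ¬ Tendsto x atBot (𝓝 0)) :
    ∃ d, 0 < d ∧ ∀ t, d ≤ ‖Real.exp t • x t‖ := by
  by_contra! hcon
  refine hlim (tendsto_zero_of_exp_smul_tendsto_zero hAn hAs hc hE hx ?_)
  rw [Metric.tendsto_nhds]
  intro ε hε
  obtain ⟨t, ht⟩ := hcon (ε / Real.exp (c * π)) (by positivity)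
  filter_upwards [eventually_le_atBot t] with s hs
  rw [dist_zero_right]
  refine (exp_smul_norm_le_of_le hAn hc hE hx hs).trans_lt ?_
  rwa [lt_div_iff₀' (Real.exp_pos _)] at ht

end Perturbation

/-- A family of linear maps, uniformly bounded above and pointwise bounded below away from zero, is
uniformly bounded below. -/
theorem exists_uniform_lower_bound {ι V W : Type*} [NormedAddCommGroup V] [NormedSpace ℝ V]
    [FiniteDimensional ℝ V] [NormedAddCommGroup W] [NormedSpace ℝ W] (Φ : ι → V →ₗ[ℝ] W) {K : ℝ}
    (hK : 0 < K) (hupper : ∀ i v, ‖Φ i v‖ ≤ K * ‖v‖)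
    (hlower : ∀ v, v ≠ 0 → ∃ d, 0 < d ∧ ∀ i, d ≤ ‖Φ i v‖) :
    ∃ d, 0 < d ∧ ∀ i v, d * ‖v‖ ≤ ‖Φ i v‖ := by
  have : ProperSpace V := FiniteDimensional.proper ℝ V
  have hsphere : ∃ d, 0 < d ∧ ∀ v ∈ Metric.sphere (0 : V) 1, ∀ i, d ≤ ‖Φ i v‖ := by
    refine (isCompact_sphere (0 : V) 1).induction_on
      (p := fun s => ∃ d, 0 < d ∧ ∀ v ∈ s, ∀ i, d ≤ ‖Φ i v‖) ⟨1, one_pos, by simp⟩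
      (fun s t hst ⟨d, hd, h⟩ => ⟨d, hd, fun v hv => h v (hst hv)⟩) ?_ ?_
    · rintro s t ⟨d, hd, h⟩ ⟨d', hd', h'⟩
      refine ⟨min d d', lt_min hd hd', ?_⟩
      rintro v (hv | hv) i
      · exact (min_le_left _ _).trans (h v hv i)
      · exact (min_le_right _ _).trans (h' v hv i)
    · intro v hv
      obtain ⟨d, hd, h⟩ := hlower v (ne_zero_of_mem_unit_sphere (⟨v, hv⟩ : Metric.sphere (0 : V) 1))
      refine ⟨Metric.ball v (d / (2 * K)),
        mem_nhdsWithin_of_mem_nhds (Metric.ball_mem_nhds v (by positivity)), d / 2, half_pos hd,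
        fun w hw i => ?_⟩
      have h1 := hupper i (v - w)
      rw [map_sub] at h1
      have h2 := norm_sub_norm_le (Φ i v) (Φ i w)
      have h3 : K * ‖v - w‖ ≤ d / 2 := by
        rw [Metric.mem_ball, dist_comm, dist_eq_norm, lt_div_iff₀ (by positivity)] at hw
        linarith
      linarith [h i]
  obtain ⟨d, hd, h⟩ := hsphere
  refine ⟨d, hd, fun i v => ?_⟩
  rcases eq_or_ne v 0 with rfl | hv
  · simp
  have hv' := norm_pos_iff.2 hv
  have := h (‖v‖⁻¹ • v) (by simp [norm_smul, hv'.ne']) i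
  rwa [map_smul, norm_smul, norm_inv, norm_norm, ← div_eq_inv_mul, le_div_iff₀ hv'] at this

theorem norm_Amap (n : ℕ) (v : EucV n) : ‖Amap n v‖ = ‖v‖ := by
  simp [Amap, EuclideanSpace.norm_eq, add_comm]

theorem inner_Amap_left (n : ℕ) (u v : EucV n) :
    inner ℝ (Amap n u) v = inner ℝ u (Amap n v) := by
  simp [Amap, PiLp.inner_apply, add_comm]

/-- The superposition `∑ j, mu j • exp t • x j t`, as a linear map in `mu`. -/
def expSuperposition {n : ℕ} (x : Fin n → ℝ → EucV n) (t : ℝ) :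
    EuclideanSpace ℝ (Fin n) →ₗ[ℝ] EucV n where
  toFun mu := Real.exp t • ∑ j, mu j • x j t
  map_add' u v := by simp [add_smul, Finset.sum_add_distrib]
  map_smul' r v := by simp [mul_smul, Finset.smul_sum, smul_comm r]

theorem IsSol.sum_smul {n : ℕ} {E : ℝ → (EucV n →L[ℝ] EucV n)} {x : Fin n → ℝ → EucV n}
    (hx : ∀ j, IsSol n E (x j)) (mu : EuclideanSpace ℝ (Fin n)) :
    IsSol n E (fun t => ∑ j, mu j • x j t) := fun t => by
  refine (HasDerivAt.fun_sum fun j (_ : j ∈ Finset.univ) =>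
    (hx j t).const_smul (mu j)).congr_deriv ?_
  simp only [map_sum, map_smul, smul_add, Finset.sum_add_distrib]

/-- Uniform exponential contraction on the stable subspace: under transversality of the stable
and unstable subspaces, there is `C > 0` with
`|x_μ(t+s)| ≤ C e^{−t} |x_μ(s)|` for all `μ ∈ ℝⁿ` and all `s, t ∈ ℝ`, where
`x_μ = Σ μ_j x_{−,j}`. -/
theorem uniform_stable_contraction
    (n : ℕ) (hn : 1 ≤ n)
    (E : ℝ → (EucV n →L[ℝ] EucV n)) (hE : Continuous E)
    (C₀ : ℝ) (hC₀ : 0 < C₀)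
    (hEb : ∀ t : ℝ, ‖E t‖ ≤ C₀ * Real.exp (-|t|))
    (xp xm : Fin n → ℝ → EucV n)
    (hxp : ∀ j, IsSol n E (xp j)) (hxm : ∀ j, IsSol n E (xm j))
    (hxpAsymp : ∀ j, Tendsto (fun t : ℝ => Real.exp (-t) • xp j t) atTop (𝓝 (eVec n 1 j)))
    (hxmAsymp : ∀ j, Tendsto (fun t : ℝ => Real.exp t • xm j t) atTop (𝓝 (eVec n (-1) j)))
    (htrans : ∀ mu : EuclideanSpace ℝ (Fin n), mu ≠ 0 →
      ¬ Tendsto (fun t : ℝ => ∑ j : Fin n, mu j • xm j t) atBot (𝓝 0)) :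
    ∃ C : ℝ, 0 < C ∧ ∀ (mu : EuclideanSpace ℝ (Fin n)) (s t : ℝ),
      ‖∑ j : Fin n, mu j • xm j (t + s)‖ ≤
        C * Real.exp (-t) * ‖∑ j : Fin n, mu j • xm j s‖ := by
  set c := C₀ * 2 with hc_def
  have hc : 0 ≤ c := by positivity
  have hEc : ∀ t, ‖E t‖ ≤ c * (1 / (1 + t ^ 2)) := fun t => by
    rw [hc_def, mul_assoc]
    exact (hEb t).trans (mul_le_mul_of_nonneg_left (exp_neg_abs_le_two_div t) hC₀.le)
  have hsol := IsSol.sum_smul hxm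
  set e := Real.exp (c * π)
  set B : ℝ := ∑ j : Fin n, ‖eVec n (-1) j‖ with hB
  have hBnn : 0 ≤ B := Finset.sum_nonneg fun _ _ => norm_nonneg _
  obtain ⟨K, hK, hupper⟩ : ∃ K, 0 < K ∧ ∀ t mu, ‖expSuperposition xm t mu‖ ≤ K * ‖mu‖ := by
    refine ⟨e * (B + 1), by positivity, fun t mu => ?_⟩
    have hlim : Tendsto (fun r => expSuperposition xm r mu) atTop
        (𝓝 (∑ j, mu j • eVec n (-1) j)) := by
      have h := tendsto_finsetSum Finset.univ fun j (_ : j ∈ Finset.univ) =>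
        (hxmAsymp j).const_smul (mu j)
      simpa [expSuperposition, Finset.smul_sum, smul_comm (Real.exp _)] using h
    have h := ge_of_tendsto (hlim.norm.const_mul e) ((eventually_ge_atTop t).mono fun r hr =>
      exp_smul_norm_le_of_le (norm_Amap n) hc hEc (hsol mu) hr)
    refine h.trans ?_
    rw [mul_assoc]
    refine mul_le_mul_of_nonneg_left ?_ (Real.exp_pos _).le
    calc ‖∑ j, mu j • eVec n (-1) j‖ ≤ ∑ j, ‖eVec n (-1) j‖ * ‖mu‖ := by
          refine norm_sum_le_of_le _ fun j _ => ?_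
          rw [norm_smul, mul_comm]
          exact mul_le_mul_of_nonneg_left (PiLp.norm_apply_le mu j) (norm_nonneg _)
      _ = B * ‖mu‖ := by rw [hB, Finset.sum_mul]
      _ ≤ (B + 1) * ‖mu‖ := by gcongr; linarith
  obtain ⟨d, hd, hlower⟩ := exists_uniform_lower_bound (expSuperposition xm)
    hK hupper fun mu hmu =>
      exists_pos_le_exp_smul_norm (norm_Amap n) (inner_Amap_left n) hc hEc (hsol mu) (htrans mu hmu)
  refine ⟨K / d, div_pos hK hd, fun mu s t => ?_⟩
  have h3 : ‖expSuperposition xm (t + s) mu‖ ≤ K / d * ‖expSuperposition xm s mu‖ := by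
    refine (hupper (t + s) mu).trans ?_
    rw [div_mul_eq_mul_div, mul_div_assoc]
    exact mul_le_mul_of_nonneg_left ((le_div_iff₀' hd).2 (hlower s mu)) hK.le
  simp only [expSuperposition, LinearMap.coe_mk, AddHom.coe_mk, norm_smul, Real.norm_eq_abs,
    Real.abs_exp] at h3
  have h4 := mul_le_mul_of_nonneg_left h3 (Real.exp_pos (-(t + s))).le
  rw [← mul_assoc, ← Real.exp_add, neg_add_cancel, Real.exp_zero, one_mul] at h4
  refine h4.trans_eq ?_
  have h5 : Real.exp (-t) = Real.exp (-(t + s)) * Real.exp s := by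
    rw [← Real.exp_add]
    congr 1
    ring
  rw [h5]
  ring

end
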